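/- arXiv:1807.07865 — 4 statements merged into one kernel-verified Lean document; each statement's English description precedes it below -/
import Mathlib

section
/- Assume in addition F(0) ≥ 0, and set μ := F(0) − (1/2)(f'(0) + f'(1)). Then μ ≥ 0 and for every s ≥ 1 one has |E(s)| ≤ μ · s². -/
open Set MeasureTheory intervalIntegral

/-- Assume in addition `F 0 ≥ 0`, and set
`μ := F 0 - (1/2)(f'(0) + f'(1))`. Then `μ ≥ 0` and for every `s ≥ 1` one has
`|E s| ≤ μ * s²`. -/
theorem taylor_remainder_bound_right (f fd fdd F E : ℝ → ℝ)
    (hfd : ∀ t ∈ Icc (0:ℝ) 1, HasDerivWithinAt f (fd t) (Icc 0 1) t)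
    (hfdd : ∀ t ∈ Icc (0:ℝ) 1, HasDerivWithinAt fd (fdd t) (Icc 0 1) t)
    (hfddc : ContinuousOn fdd (Icc 0 1))
    (hf0 : f 0 = 0) (hf1 : f 1 = 0)
    (hd0 : fd 0 < 0) (hd1 : fd 1 < 0)
    (hext0 : ∀ s ≤ (0:ℝ), f s = fd 0 * s)
    (hext1 : ∀ s ≥ (1:ℝ), f s = fd 1 * (s - 1))
    (hF : ∀ t, F t = ∫ s in t..1, f s)
    (hE : ∀ s, E s = F s - F 0 + (1/2) * fd 0 * s ^ 2)
    (hF0 : 0 ≤ F 0)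
    (μ : ℝ) (hμ : μ = F 0 - (1/2) * (fd 0 + fd 1)) :
    0 ≤ μ ∧ ∀ s ≥ (1:ℝ), |E s| ≤ μ * s ^ 2 := by
  refine ⟨by rw [hμ]; linarith, fun s hs => ?_⟩
  have hFs : F s = -fd 1 * (s - 1) ^ 2 / 2 := by
    have hcongr : ∫ x in s..1, f x = ∫ x in s..1, fd 1 * (x - 1) := by
      refine integral_congr fun x hx => ?_
      rw [uIcc_of_ge hs] at hx
      exact hext1 x hx.1
    rw [hF, hcongr, intervalIntegral.integral_const_mul,
      intervalIntegral.integral_sub (by simp) (by simp), integral_id,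
      intervalIntegral.integral_const, smul_eq_mul]
    ring
  have hs2 : 1 ≤ s ^ 2 := one_le_pow₀ hs
  have hF0s : F 0 ≤ F 0 * s ^ 2 := le_mul_of_one_le_right hF0 hs2
  have ha : 0 ≤ -fd 0 * s ^ 2 := mul_nonneg (by linarith) (by positivity)
  have hb : 0 ≤ -fd 1 * (s - 1) ^ 2 := mul_nonneg (by linarith) (by positivity)
  have hbs : -fd 1 * (s - 1) ^ 2 ≤ -fd 1 * s ^ 2 :=
    mul_le_mul_of_nonneg_left (by nlinarith) (by linarith)
  rw [hE, hFs, hμ, abs_le]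
  constructor <;> linarith
end

section
/- Assume F(0) ≥ 0, let M ≥ 0 satisfy |f''(t)| ≤ M for all t ∈ [0,1], and set μ := F(0) − (1/2)(f'(0) + f'(1)). Then for every s ∈ ℝ one has |E(s)| ≤ M·s³·𝟙_{(0,1)}(s) + μ·s²·𝟙_{[1,∞)}(s), where 𝟙_A denotes the indicator function of the set A. -/
open Set MeasureTheory intervalIntegral

/-- Quadratic Taylor bound on `[0,1]` from a bound `M` on the second derivative. -/
theorem abs_sub_linear_le_of_second_deriv_bound {f fd fdd : ℝ → ℝ} {M : ℝ}
    (hfd : ∀ t ∈ Icc (0:ℝ) 1, HasDerivWithinAt f (fd t) (Icc 0 1) t)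
    (hfdd : ∀ t ∈ Icc (0:ℝ) 1, HasDerivWithinAt fd (fdd t) (Icc 0 1) t)
    (hf0 : f 0 = 0) (hM : 0 ≤ M) (hMbound : ∀ t ∈ Icc (0:ℝ) 1, |fdd t| ≤ M)
    {r : ℝ} (hr : r ∈ Icc (0:ℝ) 1) : |f r - fd 0 * r| ≤ M * r ^ 2 := by
  have h0 : (0:ℝ) ∈ Icc (0:ℝ) 1 := by simp
  have hfd_bound : ∀ x ∈ Icc (0:ℝ) r, ‖fd x - fd 0‖ ≤ M * r := fun x hx => by
    have h := (convex_Icc (0:ℝ) 1).norm_image_sub_le_of_norm_hasDerivWithin_le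
      hfdd hMbound h0 ⟨hx.1, hx.2.trans hr.2⟩
    rw [sub_zero, Real.norm_of_nonneg hx.1] at h
    exact h.trans (mul_le_mul_of_nonneg_left hx.2 hM)
  have hderiv : ∀ x ∈ Icc (0:ℝ) r,
      HasDerivWithinAt (fun x => f x - fd 0 * x) (fd x - fd 0) (Icc 0 r) x := fun x hx => by
    have hlin : HasDerivWithinAt (fun x => fd 0 * x) (fd 0) (Icc 0 r) x := by
      simpa using (hasDerivWithinAt_id x (Icc 0 r)).const_mul (fd 0)
    exact ((hfd x ⟨hx.1, hx.2.trans hr.2⟩).mono (Icc_subset_Icc_right hr.2)).sub hlin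
  have h := (convex_Icc (0:ℝ) r).norm_image_sub_le_of_norm_hasDerivWithin_le
    hderiv hfd_bound (left_mem_Icc.2 hr.1) (right_mem_Icc.2 hr.1)
  simp only [hf0, mul_zero, sub_zero, Real.norm_eq_abs, abs_of_nonneg hr.1] at h
  linarith

/-- Assume `F 0 ≥ 0`, let `M ≥ 0` satisfy `|f''(t)| ≤ M` on `[0,1]`, and set
`μ := F 0 - (1/2)(f'(0) + f'(1))`. Then for every `s ∈ ℝ`,
`|E s| ≤ M s³ 𝟙_{(0,1)}(s) + μ s² 𝟙_{[1,∞)}(s)`. -/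
theorem taylor_remainder_global_bound (f fd fdd F E : ℝ → ℝ)
    (hfd : ∀ t ∈ Icc (0:ℝ) 1, HasDerivWithinAt f (fd t) (Icc 0 1) t)
    (hfdd : ∀ t ∈ Icc (0:ℝ) 1, HasDerivWithinAt fd (fdd t) (Icc 0 1) t)
    (hfddc : ContinuousOn fdd (Icc 0 1))
    (hf0 : f 0 = 0) (hf1 : f 1 = 0)
    (hd0 : fd 0 < 0) (hd1 : fd 1 < 0)
    (hext0 : ∀ s ≤ (0:ℝ), f s = fd 0 * s)
    (hext1 : ∀ s ≥ (1:ℝ), f s = fd 1 * (s - 1))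
    (hF : ∀ t, F t = ∫ s in t..1, f s)
    (hE : ∀ s, E s = F s - F 0 + (1/2) * fd 0 * s ^ 2)
    (hF0 : 0 ≤ F 0)
    (M : ℝ) (hM : 0 ≤ M) (hMbound : ∀ t ∈ Icc (0:ℝ) 1, |fdd t| ≤ M)
    (μ : ℝ) (hμ : μ = F 0 - (1/2) * (fd 0 + fd 1)) :
    ∀ s : ℝ,
      |E s| ≤ M * s ^ 3 * (Ioo (0:ℝ) 1).indicator (fun _ => (1:ℝ)) s +
        μ * s ^ 2 * (Ici (1:ℝ)).indicator (fun _ => (1:ℝ)) s := by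
  intro s
  have hcont : ContinuousOn f (Icc 0 1) := fun t ht => (hfd t ht).continuousWithinAt
  have hint : ∀ a ∈ Icc (0:ℝ) 1, ∀ b ∈ Icc (0:ℝ) 1, IntervalIntegrable f volume a b :=
    fun a ha b hb => (hcont.mono (uIcc_subset_Icc ha hb)).intervalIntegrable
  have h0 : (0:ℝ) ∈ Icc (0:ℝ) 1 := by simp
  have h1 : (1:ℝ) ∈ Icc (0:ℝ) 1 := by simp
  rcases le_or_gt s 0 with hs | hs
  · have heq : EqOn (fun x => fd 0 * x) f (uIcc s 0) := fun x hx => by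
      rw [uIcc_of_le hs] at hx
      exact (hext0 x hx.2).symm
    have hs_int : IntervalIntegrable f volume s 0 :=
      ((continuous_const.mul continuous_id).continuousOn.congr heq.symm).intervalIntegrable
    have hval : ∫ x in s..0, f x = - (fd 0 * s ^ 2 / 2) := by
      rw [← integral_congr heq, intervalIntegral.integral_const_mul, integral_id]
      ring
    have hE0 : E s = 0 := by
      rw [hE, hF, hF, ← integral_add_adjacent_intervals hs_int (hint 0 h0 1 h1), hval]
      ring
    simp [hE0, hs.not_gt, (hs.trans_lt one_pos).not_ge]
  rcases lt_or_ge s 1 with hs1 | hs1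
  · have hlin : Continuous fun x => fd 0 * x := by fun_prop
    have hsI : s ∈ Icc (0:ℝ) 1 := ⟨hs.le, hs1.le⟩
    have hEs : E s = - ∫ x in (0:ℝ)..s, (f x - fd 0 * x) := by
      rw [hE, hF, hF, ← integral_add_adjacent_intervals (hint 0 h0 s hsI) (hint s hsI 1 h1),
        intervalIntegral.integral_sub (hint 0 h0 s hsI) (hlin.intervalIntegrable _ _),
        intervalIntegral.integral_const_mul, integral_id]
      ring
    have hb : ∀ x ∈ uIoc 0 s, ‖f x - fd 0 * x‖ ≤ M * s ^ 2 := fun x hx => by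
      rw [uIoc_of_le hs.le] at hx
      have hx0 := hx.1.le
      refine (abs_sub_linear_le_of_second_deriv_bound hfd hfdd hf0 hM hMbound
        ⟨hx0, hx.2.trans hs1.le⟩).trans ?_
      gcongr
      exact hx.2
    have h := norm_integral_le_of_norm_le_const hb
    rw [sub_zero, abs_of_pos hs, Real.norm_eq_abs] at h
    rw [hEs, abs_neg, indicator_of_mem (show s ∈ Ioo (0:ℝ) 1 from ⟨hs, hs1⟩),
      indicator_of_notMem (show s ∉ Ici (1:ℝ) from hs1.not_ge)]
    linarith
  · have hFs : F s = - (fd 1 * (s - 1) ^ 2 / 2) := by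
      have heq : EqOn f (fun x => fd 1 * (x - 1)) (uIcc 1 s) := fun x hx => by
        rw [uIcc_of_le hs1] at hx
        exact hext1 x hx.1
      rw [hF, integral_symm, integral_congr heq, intervalIntegral.integral_const_mul,
        integral_comp_sub_right (fun x => x), integral_id]
      ring
    rw [indicator_of_notMem (show s ∉ Ioo (0:ℝ) 1 from fun h => h.2.not_ge hs1),
      indicator_of_mem (show s ∈ Ici (1:ℝ) from hs1), hE, hFs, hμ, abs_le]
    have hsq : 1 ≤ s ^ 2 := one_le_pow₀ hs1
    have hF_le : F 0 ≤ F 0 * s ^ 2 := le_mul_of_one_le_right hF0 hsq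
    have hfd0 : fd 0 * s ^ 2 ≤ 0 := mul_nonpos_of_nonpos_of_nonneg hd0.le (sq_nonneg s)
    have hfd1 : fd 1 * s ^ 2 ≤ fd 1 * (s - 1) ^ 2 :=
      mul_le_mul_of_nonpos_left (by nlinarith) hd1.le
    have hfd1' : fd 1 * (s - 1) ^ 2 ≤ 0 :=
      mul_nonpos_of_nonpos_of_nonneg hd1.le (sq_nonneg _)
    constructor <;> linarith
end

section
/- Assume F(0) ≥ 0, let M > 0 satisfy |f''(t)| ≤ M for all t ∈ [0,1], and set μ := F(0) − (1/2)(f'(0) + f'(1)). Then for every γ > 0 and every q > 2, defining γ̃ := max{M, μ} if q ≤ 3 and γ̃ := max{M·(γ/M)^{3−q}, μ} if q > 3, one has |E(s)| ≤ γ·s² + γ̃·|s|^q for all s ∈ ℝ. -/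
open Set MeasureTheory intervalIntegral

/-- If `|g''| ≤ M` on `[0,1]`, then the first-order Taylor remainder of `g` at `0` is at most
`M t ^ 2` on `[0,1]`. -/
theorem abs_sub_sub_deriv_mul_le {g g' g'' : ℝ → ℝ} {M : ℝ}
    (hg : ∀ t ∈ Icc (0:ℝ) 1, HasDerivWithinAt g (g' t) (Icc 0 1) t)
    (hg' : ∀ t ∈ Icc (0:ℝ) 1, HasDerivWithinAt g' (g'' t) (Icc 0 1) t)
    (hM : 0 ≤ M) (hbound : ∀ t ∈ Icc (0:ℝ) 1, |g'' t| ≤ M) {t : ℝ} (ht : t ∈ Icc (0:ℝ) 1) :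
    |g t - g 0 - g' 0 * t| ≤ M * t ^ 2 := by
  have h0 : (0:ℝ) ∈ Icc (0:ℝ) 1 := by simp
  have hfirst : ∀ x ∈ Icc (0:ℝ) 1, |g' x - g' 0| ≤ M * x := fun x hx => by
    have := (convex_Icc (0:ℝ) 1).norm_image_sub_le_of_norm_hasDerivWithin_le hg' hbound h0 hx
    simpa [abs_of_nonneg hx.1] using this
  have hsub : Icc 0 t ⊆ Icc (0:ℝ) 1 := Icc_subset_Icc_right ht.2
  have key := (convex_Icc (0:ℝ) t).norm_image_sub_le_of_norm_hasDerivWithin_le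
    (f := fun x => g x - g' 0 * x) (f' := fun x => g' x - g' 0) (C := M * t)
    (fun x hx => by
      simpa using ((hg x (hsub hx)).mono hsub).fun_sub
        ((hasDerivWithinAt_id x _).const_mul (g' 0)))
    (fun x hx => (hfirst x (hsub hx)).trans (mul_le_mul_of_nonneg_left hx.2 hM))
    (left_mem_Icc.2 ht.1) (right_mem_Icc.2 ht.1)
  rw [Real.norm_eq_abs, Real.norm_eq_abs, sub_zero, abs_of_nonneg ht.1] at key
  convert key using 1
  · congr 1; ring
  · ring

/-- A cubic term splits into a quadratic term and a term of power `q`. -/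
theorem mul_cube_le_quadratic_add_rpow {M γ q s : ℝ} (hM : 0 < M) (hγ : 0 < γ) (hs : 0 < s)
    (hs1 : s ≤ 1) :
    M * s ^ 3 ≤ γ * s ^ 2 + (if q ≤ 3 then M else M * (γ / M) ^ (3 - q)) * s ^ q := by
  have hsq : 0 < s ^ q := Real.rpow_pos_of_pos hs q
  split_ifs with hq
  · have h : s ^ 3 ≤ s ^ q := by
      rw [← Real.rpow_natCast s 3]
      exact Real.rpow_le_rpow_of_exponent_ge hs hs1 (by simpa using hq)
    nlinarith [mul_le_mul_of_nonneg_left h hM.le, mul_pos hγ (pow_pos hs 2)]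
  · rcases le_total (M * s) γ with h | h
    · have h' : 0 < M * (γ / M) ^ (3 - q) * s ^ q := by positivity
      nlinarith [mul_le_mul_of_nonneg_right h (sq_nonneg s)]
    · have hpow : s ^ (3 - q) ≤ (γ / M) ^ (3 - q) :=
        Real.rpow_le_rpow_of_nonpos (by positivity) (by rwa [div_le_iff₀' hM])
          (by linarith [not_le.1 hq])
      have hsplit : s ^ 3 = s ^ (3 - q) * s ^ q := by
        rw [← Real.rpow_add hs, sub_add_cancel, ← Real.rpow_natCast s 3]; norm_num
      have := mul_le_mul_of_nonneg_left (mul_le_mul_of_nonneg_right hpow hsq.le) hM.le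
      rw [hsplit]
      nlinarith [mul_pos hγ (pow_pos hs 2)]

/-- Assume `F 0 ≥ 0`, let `M > 0` satisfy `|f''(t)| ≤ M` on `[0,1]`, and set
`μ := F 0 - (1/2)(f'(0) + f'(1))`. Then for every `γ > 0` and every `q > 2`, defining
`γ̃ := max {M, μ}` if `q ≤ 3` and `γ̃ := max {M (γ/M)^(3-q), μ}` if `q > 3`, one has
`|E s| ≤ γ s² + γ̃ |s|^q` for all `s ∈ ℝ`. -/
theorem taylor_remainder_power_bound (f fd fdd F E : ℝ → ℝ)
    (hfd : ∀ t ∈ Icc (0:ℝ) 1, HasDerivWithinAt f (fd t) (Icc 0 1) t)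
    (hfdd : ∀ t ∈ Icc (0:ℝ) 1, HasDerivWithinAt fd (fdd t) (Icc 0 1) t)
    (hfddc : ContinuousOn fdd (Icc 0 1))
    (hf0 : f 0 = 0) (hf1 : f 1 = 0)
    (hd0 : fd 0 < 0) (hd1 : fd 1 < 0)
    (hext0 : ∀ s ≤ (0:ℝ), f s = fd 0 * s)
    (hext1 : ∀ s ≥ (1:ℝ), f s = fd 1 * (s - 1))
    (hF : ∀ t, F t = ∫ s in t..1, f s)
    (hE : ∀ s, E s = F s - F 0 + (1/2) * fd 0 * s ^ 2)
    (hF0 : 0 ≤ F 0)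
    (M : ℝ) (hM : 0 < M) (hMbound : ∀ t ∈ Icc (0:ℝ) 1, |fdd t| ≤ M)
    (μ : ℝ) (hμ : μ = F 0 - (1/2) * (fd 0 + fd 1)) :
    ∀ γ > (0:ℝ), ∀ q > (2:ℝ), ∀ s : ℝ,
      |E s| ≤ γ * s ^ 2 +
        (if q ≤ 3 then max M μ else max (M * (γ / M) ^ (3 - q)) μ) * |s| ^ q := by
  intro γ hγ q hq s
  have hcont : ContinuousOn f (Icc 0 1) := fun t ht => (hfd t ht).continuousWithinAt
  have hfint : ∀ a ∈ Icc (0:ℝ) 1, ∀ b ∈ Icc (0:ℝ) 1, IntervalIntegrable f volume a b :=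
    fun a ha b hb => (hcont.mono (uIcc_subset_Icc ha hb)).intervalIntegrable
  have h0 : (0:ℝ) ∈ Icc (0:ℝ) 1 := by simp
  have h1 : (1:ℝ) ∈ Icc (0:ℝ) 1 := by simp
  have hμ0 : 0 < μ := by rw [hμ]; linarith
  have hcoef : max (if q ≤ 3 then M else M * (γ / M) ^ (3 - q)) μ =
      if q ≤ 3 then max M μ else max (M * (γ / M) ^ (3 - q)) μ := by split_ifs <;> rfl
  rw [← hcoef]
  set A : ℝ := if q ≤ 3 then M else M * (γ / M) ^ (3 - q)
  have hrpow : 0 ≤ |s| ^ q := by positivity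
  rcases le_or_gt s 0 with hs | hs
  · have hcongr : EqOn f (fun t => fd 0 * t) (uIcc s 0) := fun t ht => by
      rw [uIcc_of_le hs] at ht
      exact hext0 t ht.2
    have hfint' : IntervalIntegrable f volume s 0 :=
      ((continuous_const.mul continuous_id).continuousOn.congr hcongr).intervalIntegrable
    have hE0 : E s = 0 := by
      rw [hE, hF, hF, ← integral_add_adjacent_intervals hfint' (hfint 0 h0 1 h1),
        integral_congr hcongr, intervalIntegral.integral_const_mul, integral_id]
      ring
    rw [hE0, abs_zero]
    have : 0 ≤ max A μ := hμ0.le.trans (le_max_right _ _)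
    positivity
  rw [abs_of_pos hs] at hrpow ⊢
  rcases le_or_gt s 1 with hs1 | hs1
  · have hsI : s ∈ Icc (0:ℝ) 1 := ⟨hs.le, hs1⟩
    have hEint : E s = -∫ t in (0:ℝ)..s, (f t - fd 0 * t) := by
      rw [hE, hF, hF, ← integral_add_adjacent_intervals (hfint 0 h0 s hsI) (hfint s hsI 1 h1),
        intervalIntegral.integral_sub (hfint 0 h0 s hsI)
          (intervalIntegrable_id.const_mul (fd 0)),
        intervalIntegral.integral_const_mul, integral_id]
      ring
    have hcubic : |E s| ≤ M * s ^ 3 := by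
      rw [hEint, abs_neg]
      have := norm_integral_le_of_norm_le_const (f := fun t => f t - fd 0 * t) (a := 0) (b := s)
        (C := M * s ^ 2) fun t ht => by
          rw [uIoc_of_le hs.le] at ht
          have h := abs_sub_sub_deriv_mul_le hfd hfdd hM.le hMbound
            (⟨ht.1.le, ht.2.trans hs1⟩ : t ∈ Icc (0:ℝ) 1)
          rw [hf0, sub_zero] at h
          exact h.trans (mul_le_mul_of_nonneg_left (pow_le_pow_left₀ ht.1.le ht.2 2) hM.le)
      rw [Real.norm_eq_abs, sub_zero, abs_of_pos hs] at this
      linarith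
    have hsplit := mul_cube_le_quadratic_add_rpow (q := q) hM hγ hs hs1
    have := mul_le_mul_of_nonneg_right (le_max_left A μ) hrpow
    linarith
  · have hcongr : EqOn f (fun t => fd 1 * (t - 1)) (uIcc s 1) := fun t ht => by
      rw [uIcc_of_ge hs1.le] at ht
      exact hext1 t ht.1
    have hFs : F s = -fd 1 * (s - 1) ^ 2 / 2 := by
      rw [hF, integral_congr hcongr, intervalIntegral.integral_const_mul,
        intervalIntegral.integral_sub intervalIntegrable_id intervalIntegrable_const,
        integral_id, intervalIntegral.integral_const, smul_eq_mul]
      ring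
    have hquad : |E s| ≤ μ * s ^ 2 := by
      have hsq : 1 ≤ s ^ 2 := one_le_pow₀ hs1.le
      rw [abs_le, hE, hFs, hμ]
      constructor
      · nlinarith [mul_nonneg hF0 (sub_nonneg.2 hsq), mul_nonneg (neg_pos.2 hd1).le (sq_nonneg s),
          mul_nonneg (neg_pos.2 hd1).le (sq_nonneg (s - 1))]
      · nlinarith [mul_nonneg hF0 (sq_nonneg s), mul_nonneg (neg_pos.2 hd0).le (sq_nonneg s),
          mul_nonneg (neg_pos.2 hd1).le (by linarith : 0 ≤ 2 * s - 1)]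
    have hpow : s ^ 2 ≤ s ^ q := by
      rw [← Real.rpow_natCast s 2]
      exact Real.rpow_le_rpow_of_exponent_le hs1.le (by simpa using hq.le)
    have hmax := mul_le_mul_of_nonneg_right (le_max_right A μ) hrpow
    have := mul_le_mul_of_nonneg_left hpow hμ0.le
    have : 0 ≤ γ * s ^ 2 := by positivity
    linarith
end

section
/- There exists a constant K > 0 such that F(s) ≥ K·(s−1)² for all s ∈ ℝ. -/
open Set MeasureTheory intervalIntegral
open Filter Topology

/-- A function continuous on `[0,1]`, vanishing at the endpoints and linearly extended outside,
is continuous. -/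
theorem continuous_of_linear_extension {f : ℝ → ℝ} {a b : ℝ} (hf : ContinuousOn f (Icc 0 1))
    (hf0 : f 0 = 0) (hf1 : f 1 = 0) (hext0 : ∀ s ≤ (0:ℝ), f s = a * s)
    (hext1 : ∀ s ≥ (1:ℝ), f s = b * (s - 1)) : Continuous f := by
  have h : f = fun s => f (max 0 (min 1 s)) + a * min s 0 + b * (max s 1 - 1) := by
    funext s
    rcases le_total s 0 with h0 | h0
    · have h1 : s ≤ 1 := by linarith
      simp [h0, h1, hf0, hext0 s h0]
    · rcases le_total s 1 with h1 | h1
      · simp [h0, h1]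
      · simp [h0, h1, hf1, hext1 s h1]
  rw [h]
  have hc : Continuous fun s : ℝ => f (max 0 (min 1 s)) :=
    hf.comp_continuous (by fun_prop) fun s =>
      ⟨le_max_left _ _, max_le zero_le_one (min_le_left _ _)⟩
  exact (hc.add (by fun_prop)).add (by fun_prop)

/-- A function vanishing at `1` with negative left derivative `d` there lies above a line of
slope `d / 2` on a left neighbourhood of `1`. -/
theorem exists_linear_lower_bound {f : ℝ → ℝ} {d θ : ℝ} (hθ : θ ∈ Ioo (0:ℝ) 1)
    (hf : HasDerivWithinAt f d (Icc 0 1) 1) (hf1 : f 1 = 0) (hd : d < 0) :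
    ∃ a ∈ Ioo θ 1, ∀ u ∈ Icc a 1, -d / 2 * (1 - u) ≤ f u := by
  have hs : Tendsto (slope f 1) (𝓝[<] 1) (𝓝 d) := by
    rw [← hasDerivWithinAt_iff_tendsto_slope' (by simp)]
    exact hf.mono_of_mem_nhdsWithin (Icc_mem_nhdsLT zero_lt_one)
  have he : ∀ᶠ u in 𝓝[<] (1:ℝ), slope f 1 u < d / 2 := hs.eventually_lt_const (by linarith)
  obtain ⟨b, hb, hbs⟩ := (mem_nhdsLT_iff_exists_Ioo_subset' hθ.2).1 he
  have hb1 : b < 1 := hb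
  obtain ⟨a, ha, ha1⟩ := exists_between (max_lt hθ.2 hb1)
  refine ⟨a, ⟨(le_max_left _ _).trans_lt ha, ha1⟩, fun u hu => ?_⟩
  rcases hu.2.eq_or_lt with rfl | hu1
  · simp [hf1]
  · have h : slope f 1 u < d / 2 := hbs ⟨((le_max_right _ _).trans_lt ha).trans_le hu.1, hu1⟩
    rw [slope_def_field, hf1, sub_zero, div_lt_iff_of_neg (by linarith)] at h
    linarith

/-- For a bistable nonlinearity `f` (linearly extended outside `[0,1]`) with
positive mass, there exists `K > 0` such that `F s ≥ K (s-1)²` for all `s ∈ ℝ`. -/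
theorem potential_quadratic_lower_bound (f fd fdd F : ℝ → ℝ)
    (hfd : ∀ t ∈ Icc (0:ℝ) 1, HasDerivWithinAt f (fd t) (Icc 0 1) t)
    (hfdd : ∀ t ∈ Icc (0:ℝ) 1, HasDerivWithinAt fd (fdd t) (Icc 0 1) t)
    (hfddc : ContinuousOn fdd (Icc 0 1))
    (hf0 : f 0 = 0) (hf1 : f 1 = 0)
    (hd0 : fd 0 < 0) (hd1 : fd 1 < 0)
    (hext0 : ∀ s ≤ (0:ℝ), f s = fd 0 * s)
    (hext1 : ∀ s ≥ (1:ℝ), f s = fd 1 * (s - 1))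
    (θ : ℝ) (hθ : θ ∈ Ioo (0:ℝ) 1)
    (hneg : ∀ s ∈ Ioo (0:ℝ) θ, f s < 0)
    (hpos : ∀ s ∈ Ioo θ 1, 0 < f s)
    (hmass : 0 < ∫ s in (0:ℝ)..1, f s)
    (hF : ∀ t, F t = ∫ s in t..1, f s) :
    ∃ K > (0:ℝ), ∀ s : ℝ, K * (s - 1) ^ 2 ≤ F s := by
  have hc : Continuous f := continuous_of_linear_extension
    (fun t ht => (hfd t ht).continuousWithinAt) hf0 hf1 hext0 hext1
  have hi : ∀ x y, IntervalIntegrable f volume x y := fun x y => hc.intervalIntegrable x y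
  have hadd : ∀ x y, F x = (∫ u in x..y, f u) + F y := fun x y => by
    rw [hF, hF, integral_add_adjacent_intervals (hi x y) (hi y 1)]
  obtain ⟨a, ha, hlow⟩ := exists_linear_lower_bound hθ (hfd 1 (by simp)) hf1 hd1
  have hM : 0 < F 0 := by rwa [hF]
  have hnear : ∀ s ∈ Icc a 1, -fd 1 / 4 * (s - 1) ^ 2 ≤ F s := fun s hs => by
    have h : ∫ u in s..1, -fd 1 / 2 * (1 - u) ≤ ∫ u in s..1, f u :=
      integral_mono_on hs.2 (Continuous.intervalIntegrable (by fun_prop) _ _) (hi s 1)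
        fun u hu => hlow u ⟨hs.1.trans hu.1, hu.2⟩
    have he : ∫ u in s..1, -fd 1 / 2 * (1 - u) = -fd 1 / 4 * (s - 1) ^ 2 := by
      rw [intervalIntegral.integral_const_mul,
        intervalIntegral.integral_sub (by simp) (by simp), integral_id]
      simp
      ring
    rw [hF, ← he]
    exact h
  have hFa : 0 < F a := lt_of_lt_of_le
    (mul_pos (by linarith) (sq_pos_of_neg (sub_neg.2 ha.2))) (hnear a ⟨le_rfl, ha.2.le⟩)
  have hmid : ∀ s ∈ Icc θ a, F a ≤ F s := fun s hs => by
    have h : 0 ≤ ∫ u in s..a, f u := by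
      rw [integral_of_le hs.2]
      exact setIntegral_nonneg measurableSet_Ioc fun u hu =>
        (hpos u ⟨hs.1.trans_lt hu.1, hu.2.trans_lt ha.2⟩).le
    linarith [hadd s a]
  have hleft : ∀ s ∈ Icc 0 θ, F 0 ≤ F s := fun s hs => by
    have h : 0 ≤ ∫ u in (0:ℝ)..s, -f u := by
      rw [integral_of_le hs.1, integral_Ioc_eq_integral_Ioo]
      exact setIntegral_nonneg measurableSet_Ioo fun u hu =>
        neg_nonneg.2 (hneg u ⟨hu.1, hu.2.trans_le hs.2⟩).le
    rw [intervalIntegral.integral_neg] at h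
    linarith [hadd 0 s]
  have hlt : ∀ s ≤ 0, F s = F 0 - fd 0 / 2 * s ^ 2 := fun s hs => by
    have h : ∫ u in s..0, f u = ∫ u in s..0, fd 0 * u :=
      integral_congr fun u hu => hext0 u (by rw [uIcc_of_le hs] at hu; exact hu.2)
    rw [hadd s 0, h, intervalIntegral.integral_const_mul, integral_id]
    ring
  have hgt : ∀ s ≥ 1, F s = -fd 1 / 2 * (s - 1) ^ 2 := fun s hs => by
    have h : ∫ u in s..1, f u = ∫ u in s..1, fd 1 * (u - 1) :=
      integral_congr fun u hu => hext1 u (by rw [uIcc_of_ge hs] at hu; exact hu.1)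
    rw [hF, h, intervalIntegral.integral_const_mul,
      intervalIntegral.integral_sub (by simp) (by simp), integral_id]
    simp
    ring
  obtain ⟨K, hK, hKlt⟩ : ∃ K > 0, K < min (min (-fd 1 / 4) (-fd 0 / 4)) (min (F a) (F 0 / 2)) :=
    exists_between (by simp only [lt_min_iff]; refine ⟨⟨?_, ?_⟩, ?_, ?_⟩ <;> linarith)
  simp only [lt_min_iff] at hKlt
  obtain ⟨⟨hK1, hK0⟩, hKa, hKM⟩ := hKlt
  have hunit : ∀ s ∈ Icc (0:ℝ) 1, K * (s - 1) ^ 2 ≤ K := fun s hs =>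
    mul_le_of_le_one_right hK.le (by nlinarith [hs.1, hs.2])
  refine ⟨K, hK, fun s => ?_⟩
  rcases le_total s 0 with h0 | h0
  · rw [hlt s h0]
    nlinarith [mul_nonneg hK.le (sq_nonneg (s + 1)),
      mul_nonneg (sub_nonneg.2 hK0.le) (sq_nonneg s)]
  rcases le_total 1 s with h1 | h1
  · rw [hgt s h1]
    exact mul_le_mul_of_nonneg_right (by linarith) (sq_nonneg _)
  rcases le_total a s with has | has
  · exact (mul_le_mul_of_nonneg_right hK1.le (sq_nonneg _)).trans (hnear s ⟨has, h1⟩)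
  · rcases le_total s θ with hsθ | hsθ
    · linarith [hunit s ⟨h0, h1⟩, hleft s ⟨h0, hsθ⟩]
    · linarith [hunit s ⟨h0, h1⟩, hmid s ⟨hsθ, has⟩]
end
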